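/- Let ε > 0 be real, let q be a positive integer and χ a primitive Dirichlet character mod q, and let H ≤ q be a positive integer. Let 0 ≤ N_1 < N_2 < ⋯ < N_J < q be integers satisfying the spacing condition N_{j+1} − N_j ≥ H for all 1 ≤ j < J. Then there is a constant C = C(ε) such that ∑_{j=1}^{J} max_{1 ≤ h ≤ H} |S(N_j; h)|^2 ≤ C · q^{1 + ε}. -/

import Mathlib

open Finset

/-- The sum of `f` over the `h` consecutive residues starting at `x`. -/
noncomputable def shortSum {q : ℕ} (f : ZMod q → ℂ) (x : ZMod q) (h : ℕ) : ℂ :=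
  ∑ m ∈ range h, f (x + m)

lemma shortSum_add {q : ℕ} (f : ZMod q → ℂ) (x : ZMod q) (a b : ℕ) :
    shortSum f x (a + b) = shortSum f x a + shortSum f (x + a) b := by
  simp [shortSum, sum_range_add, add_assoc]

/-- Parseval's identity on `ZMod q`. -/
lemma sum_norm_sq_sum_mul_stdAddChar {q : ℕ} [NeZero q] (c : ZMod q → ℂ) :
    ∑ x : ZMod q, ‖∑ a, c a * ZMod.stdAddChar (a * x)‖ ^ 2 = q * ∑ a, ‖c a‖ ^ 2 := by
  have key (x : ZMod q) : ((‖∑ a, c a * ZMod.stdAddChar (a * x)‖ ^ 2 : ℝ) : ℂ) =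
      ∑ a, ∑ b, c a * (starRingEnd ℂ) (c b) * ZMod.stdAddChar (x * (a - b)) := by
    rw [Complex.ofReal_pow, ← Complex.mul_conj', map_sum, sum_mul_sum]
    refine sum_congr rfl fun a _ => sum_congr rfl fun b _ => ?_
    rw [map_mul (starRingEnd ℂ), ← AddChar.map_neg_eq_conj, mul_mul_mul_comm, ← AddChar.map_add_eq_mul]
    congr 2
    ring
  apply Complex.ofReal_injective
  rw [Complex.ofReal_sum]
  simp_rw [key]
  rw [sum_comm]
  simp_rw [sum_comm (s := (univ : Finset (ZMod q))) (t := univ)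
    (f := fun x b => c _ * (starRingEnd ℂ) (c b) * ZMod.stdAddChar (x * (_ - b))), ← mul_sum,
    AddChar.sum_mulShift _ (ZMod.isPrimitive_stdAddChar q), sub_eq_zero]
  simp [mul_sum, Complex.mul_conj', mul_comm]

lemma norm_gaussSum_sq_of_isPrimitive {q : ℕ} [NeZero q] {χ : DirichletCharacter ℂ q}
    (hχ : χ.IsPrimitive) : ‖gaussSum χ (ZMod.stdAddChar (N := q))‖ ^ 2 = q := by
  have h := sum_norm_sq_sum_mul_stdAddChar (fun a => χ a)
  have h1 (x : ZMod q) : ∑ a, χ a * ZMod.stdAddChar (a * x) =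
      χ⁻¹ x * gaussSum χ (ZMod.stdAddChar (N := q)) := by
    rw [← gaussSum_mulShift_of_isPrimitive _ hχ, gaussSum]
    simp [AddChar.mulShift_apply, mul_comm]
  have h2 (x : ZMod q) : ‖χ⁻¹ x‖ = ‖χ x‖ := by
    rw [← χ.star_eq_inv, MulChar.star_apply, norm_star]
  simp_rw [h1, norm_mul, mul_pow, h2, ← sum_mul] at h
  rw [mul_comm] at h
  refine mul_right_cancel₀ (ne_of_gt ?_) h
  exact sum_pos' (fun _ _ => by positivity) ⟨1, mem_univ _, by simp⟩

lemma sum_norm_shortSum_sq_le {q : ℕ} [NeZero q] {χ : DirichletCharacter ℂ q}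
    (hχ : χ.IsPrimitive) {h : ℕ} (hq : h ≤ q) :
    ∑ x, ‖shortSum χ x h‖ ^ 2 ≤ (q : ℝ) * h := by
  set τ := gaussSum χ (ZMod.stdAddChar (N := q)) with hτ
  set D : ZMod q → ℂ := fun a => ∑ m ∈ range h, ZMod.stdAddChar (a * (m : ZMod q)) with hD
  have hchar (x : ZMod q) : ‖shortSum χ x h‖ * ‖τ‖ =
      ‖∑ a, χ a * D a * ZMod.stdAddChar (a * x)‖ := by
    have : ‖shortSum χ x h‖ = ‖∑ m ∈ range h, χ⁻¹ (x + m)‖ := by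
      rw [← norm_star, shortSum, star_sum]
      simp_rw [← χ.star_eq_inv, MulChar.star_apply]
    rw [this, ← norm_mul, sum_mul]
    simp_rw [hτ, ← gaussSum_mulShift_of_isPrimitive _ hχ, gaussSum, hD, mul_sum, sum_mul]
    rw [sum_comm]
    congr 1
    refine sum_congr rfl fun a _ => sum_congr rfl fun m _ => ?_
    rw [AddChar.mulShift_apply, mul_assoc, ← AddChar.map_add_eq_mul]
    congr 2
    ring
  have hcast : Set.InjOn (fun m : ℕ => (m : ZMod q)) (range h) := by
    intro m hm n hn hmn
    simp only [coe_range, Set.mem_Iio] at hm hn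
    have := (ZMod.natCast_eq_natCast_iff' m n q).1 hmn
    rwa [Nat.mod_eq_of_lt (hm.trans_le hq), Nat.mod_eq_of_lt (hn.trans_le hq)] at this
  have hDsum : ∑ a, ‖D a‖ ^ 2 = (q : ℝ) * h := by
    have hp := sum_norm_sq_sum_mul_stdAddChar
      (fun b : ZMod q => if b ∈ (range h).image (fun m : ℕ => (m : ZMod q)) then (1 : ℂ) else 0)
    simp_rw [ite_mul, one_mul, zero_mul, sum_ite_mem, univ_inter, sum_image hcast] at hp
    simp_rw [hD, mul_comm _ ((_ : ℕ) : ZMod q), hp]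
    simp only [apply_ite norm, norm_one, norm_zero, ite_pow, one_pow, ne_eq, OfNat.ofNat_ne_zero,
      not_false_eq_true, zero_pow, sum_ite_mem, univ_inter, sum_image hcast]
    simp
  have hq0 : (0 : ℝ) < q := by exact_mod_cast NeZero.pos q
  have hpars := sum_norm_sq_sum_mul_stdAddChar (fun a => χ a * D a)
  simp_rw [← hchar, mul_pow, ← sum_mul, hτ, norm_gaussSum_sq_of_isPrimitive hχ] at hpars
  rw [mul_comm] at hpars
  rw [mul_left_cancel₀ hq0.ne' hpars, ← hDsum]
  refine sum_le_sum fun a _ => ?_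
  rw [norm_mul]
  gcongr
  exact mul_le_of_le_one_left (norm_nonneg _) (χ.norm_le_one a)

lemma norm_add_sq_le_two_mul (a b : ℂ) : ‖a + b‖ ^ 2 ≤ 2 * (‖a‖ ^ 2 + ‖b‖ ^ 2) := by
  have := norm_add_le a b
  nlinarith [sq_nonneg (‖a‖ - ‖b‖), norm_nonneg (a + b), norm_nonneg a, norm_nonneg b]

lemma sum_norm_shortSum_sq_le_two_mul {q : ℕ} [NeZero q] {χ : DirichletCharacter ℂ q}
    (hχ : χ.IsPrimitive) {l : ℕ} (hl : 2 ^ l ≤ 2 * q) :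
    ∑ x, ‖shortSum χ x (2 ^ l)‖ ^ 2 ≤ 2 * q * (2 : ℝ) ^ l := by
  have hq0 := NeZero.pos q
  rcases l with - | l
  · have := sum_norm_shortSum_sq_le hχ (h := 1) hq0
    push_cast at this
    simp only [pow_zero]
    linarith [(Nat.cast_nonneg q : (0 : ℝ) ≤ q)]
  · have hl' : 2 ^ l ≤ q := by rw [pow_succ] at hl; omega
    have hm := sum_norm_shortSum_sq_le hχ hl'
    have ht : ∑ x, ‖shortSum χ (x + (2 ^ l : ℕ)) (2 ^ l)‖ ^ 2 =
        ∑ x, ‖shortSum χ x (2 ^ l)‖ ^ 2 :=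
      Equiv.sum_comp (Equiv.addRight (((2 ^ l : ℕ) : ZMod q))) fun x => ‖shortSum χ x (2 ^ l)‖ ^ 2
    calc ∑ x, ‖shortSum χ x (2 ^ (l + 1))‖ ^ 2
        ≤ ∑ x, 2 * (‖shortSum χ x (2 ^ l)‖ ^ 2 +
            ‖shortSum χ (x + (2 ^ l : ℕ)) (2 ^ l)‖ ^ 2) := by
          refine sum_le_sum fun x _ => ?_
          rw [pow_succ 2 l, mul_two, shortSum_add]
          exact norm_add_sq_le_two_mul _ _
      _ ≤ 2 * q * (2 : ℝ) ^ (l + 1) := by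
          rw [← mul_sum, sum_add_distrib, ht, pow_succ]
          push_cast at hm
          linarith

/-- The Rademacher–Menshov majorant of `‖shortSum f x h‖ ^ 2` over all `h < 2 ^ K`. -/
noncomputable def dyadicMajorant {q : ℕ} (f : ZMod q → ℂ) (K : ℕ) (x : ZMod q) : ℝ :=
  K * ∑ l ∈ range K, ∑ v ∈ range (2 ^ (K - l)), ‖shortSum f (x + (v * 2 ^ l : ℕ)) (2 ^ l)‖ ^ 2

lemma dyadicMajorant_nonneg {q : ℕ} (f : ZMod q → ℂ) (K : ℕ) (x : ZMod q) :
    0 ≤ dyadicMajorant f K x := by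
  unfold dyadicMajorant
  positivity

lemma norm_shortSum_sq_le_dyadicMajorant {q : ℕ} (f : ZMod q → ℂ) {K h : ℕ} (hh : h < 2 ^ K)
    (x : ZMod q) : ‖shortSum f x h‖ ^ 2 ≤ dyadicMajorant f K x := by
  set P : ℕ → ℂ := fun l => shortSum f x (h / 2 ^ l * 2 ^ l) with hP
  have htel : shortSum f x h = ∑ l ∈ range K, (P l - P (l + 1)) := by
    rw [sum_range_sub']
    simp [hP, Nat.div_eq_of_lt hh, shortSum]
  have hstep (l : ℕ) (hl : l ∈ range K) : ‖P l - P (l + 1)‖ ^ 2 ≤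
      ∑ v ∈ range (2 ^ (K - l)), ‖shortSum f (x + (v * 2 ^ l : ℕ)) (2 ^ l)‖ ^ 2 := by
    have hlK := (mem_range.1 hl).le
    have hlt : h / 2 ^ l < 2 ^ (K - l) := by
      rw [Nat.div_lt_iff_lt_mul (by positivity), ← pow_add, Nat.sub_add_cancel hlK]
      exact hh
    have hdiv : h / 2 ^ (l + 1) = h / 2 ^ l / 2 := by rw [pow_succ, Nat.div_div_eq_div_mul]
    have hP1 : P (l + 1) = shortSum f x (2 * (h / 2 ^ l / 2) * 2 ^ l) := by
      simp only [hP, hdiv]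
      congr 1
      ring
    rcases Nat.mod_two_eq_zero_or_one (h / 2 ^ l) with h0 | h1
    · have : 2 * (h / 2 ^ l / 2) = h / 2 ^ l := by omega
      rw [hP1, this]
      simp only [hP, sub_self, norm_zero, ne_eq, OfNat.ofNat_ne_zero, not_false_eq_true, zero_pow]
      positivity
    · have : h / 2 ^ l = 2 * (h / 2 ^ l / 2) + 1 := by omega
      have hPl : P l = P (l + 1) +
          shortSum f (x + (2 * (h / 2 ^ l / 2) * 2 ^ l : ℕ)) (2 ^ l) := by
        rw [hP1, ← shortSum_add]
        simp only [hP]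
        congr 1
        nth_rw 1 [this]
        ring
      rw [hPl, add_sub_cancel_left]
      exact single_le_sum (f := fun v : ℕ => ‖shortSum f (x + (v * 2 ^ l : ℕ)) (2 ^ l)‖ ^ 2)
        (fun _ _ => by positivity) (mem_range.2 (by omega))
  calc ‖shortSum f x h‖ ^ 2 ≤ (∑ l ∈ range K, ‖P l - P (l + 1)‖) ^ 2 := by
        rw [htel]
        gcongr
        exact norm_sum_le _ _
    _ ≤ K * ∑ l ∈ range K, ‖P l - P (l + 1)‖ ^ 2 := by
        simpa using sq_sum_le_card_mul_sum_sq (s := range K) (f := fun l => ‖P l - P (l + 1)‖)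
    _ ≤ dyadicMajorant f K x := by
        unfold dyadicMajorant
        gcongr with l hl
        exact hstep l hl

lemma sum_dyadicMajorant_le {q : ℕ} [NeZero q] {χ : DirichletCharacter ℂ q}
    (hχ : χ.IsPrimitive) {K : ℕ} (hK : 2 ^ K ≤ 4 * q) :
    ∑ x, dyadicMajorant χ K x ≤ 2 * (K : ℝ) ^ 2 * 2 ^ K * q := by
  unfold dyadicMajorant
  rw [← mul_sum, sum_comm]
  have hlevel (l : ℕ) (hl : l ∈ range K) : ∑ x, ∑ v ∈ range (2 ^ (K - l)),
      ‖shortSum χ (x + (v * 2 ^ l : ℕ)) (2 ^ l)‖ ^ 2 ≤ 2 * q * (2 : ℝ) ^ K := by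
    have hlK := mem_range.1 hl
    have h2l : 2 ^ l ≤ 2 * q := by
      have : 2 ^ (l + 1) ≤ 2 ^ K := Nat.pow_le_pow_right (by norm_num) hlK
      rw [pow_succ] at this
      omega
    have ht (v : ℕ) : ∑ x, ‖shortSum χ (x + (v * 2 ^ l : ℕ)) (2 ^ l)‖ ^ 2 =
        ∑ x, ‖shortSum χ x (2 ^ l)‖ ^ 2 :=
      Equiv.sum_comp (Equiv.addRight (((v * 2 ^ l : ℕ) : ZMod q)))
        fun x => ‖shortSum χ x (2 ^ l)‖ ^ 2
    rw [sum_comm]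
    simp_rw [ht]
    rw [sum_const, card_range, nsmul_eq_mul]
    calc _ ≤ ((2 ^ (K - l) : ℕ) : ℝ) * (2 * q * (2 : ℝ) ^ l) := by
          gcongr
          exact sum_norm_shortSum_sq_le_two_mul hχ h2l
      _ = 2 * q * ((2 : ℝ) ^ (K - l) * 2 ^ l) := by push_cast; ring
      _ = _ := by rw [← pow_add, Nat.sub_add_cancel hlK.le]
  calc _ ≤ (K : ℝ) * ∑ l ∈ range K, 2 * q * (2 : ℝ) ^ K := by
        gcongr with l hl
        exact hlevel l hl
    _ = _ := by rw [sum_const, card_range, nsmul_eq_mul]; ring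

lemma sum_range_natCast_zmod {q : ℕ} [NeZero q] (g : ZMod q → ℝ) :
    ∑ n ∈ range q, g n = ∑ x, g x := by
  refine sum_bij' (fun n _ => (n : ZMod q)) (fun x _ => x.val) ?_ ?_ ?_ ?_ ?_
  · simp
  · simp [ZMod.val_lt]
  · intro n hn
    exact ZMod.val_cast_of_lt (mem_range.1 hn)
  · simp
  · simp

lemma sum_sum_Ico_le_sum_range {G : ℕ → ℝ} (hG : ∀ n, 0 ≤ G n) {H J Q : ℕ} {N : ℕ → ℕ}
    (hN : ∀ j, 1 ≤ j → j < J → N j + H ≤ N (j + 1)) (hQ : ∀ j, 1 ≤ j → j ≤ J → N j + H ≤ Q) :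
    ∑ j ∈ Icc 1 J, ∑ n ∈ Ico (N j) (N j + H), G n ≤ ∑ n ∈ range Q, G n := by
  induction J generalizing Q with
  | zero => simpa using sum_nonneg fun n _ => hG n
  | succ J ih =>
    have hlast := hQ (J + 1) (by omega) le_rfl
    rw [sum_Icc_succ_top (by omega)]
    calc _ ≤ ∑ n ∈ range (N (J + 1)), G n + ∑ n ∈ Ico (N (J + 1)) (N (J + 1) + H), G n := by
          gcongr
          refine ih (fun j h1 hj => hN j h1 (by omega)) fun j h1 hj => ?_
          rcases hj.eq_or_lt with rfl | hj
          · exact hN j h1 (by omega)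
          · have hmono : ∀ i, j + 1 ≤ i → i ≤ J + 1 → N (j + 1) ≤ N i := by
              intro i hi
              induction i, hi using Nat.le_induction with
              | base => simp
              | succ i hi ihi =>
                intro hiJ
                have := ihi (by omega)
                have := hN i (by omega) (by omega)
                omega
            exact (hN j h1 (by omega)).trans (hmono (J + 1) (by omega) le_rfl)
      _ = ∑ n ∈ range (N (J + 1) + H), G n := sum_range_add_sum_Ico _ (by omega)
      _ ≤ _ := sum_le_sum_of_subset_of_nonneg (range_mono hlast) fun n _ _ => hG n

lemma norm_shortSum_sq_le_of_shift {q : ℕ} (f : ZMod q → ℂ) {K H h i : ℕ} (hK : 2 * H < 2 ^ K)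
    (hh : h ≤ H) (hi : i ≤ H) (x : ZMod q) :
    ‖shortSum f (x + i) h‖ ^ 2 ≤ 4 * dyadicMajorant f K x := by
  have h1 := norm_shortSum_sq_le_dyadicMajorant f (show i + h < 2 ^ K by omega) x
  have h2 := norm_shortSum_sq_le_dyadicMajorant f (show i < 2 ^ K by omega) x
  have h3 := norm_add_sq_le_two_mul (shortSum f x (i + h)) (-shortSum f x i)
  rw [shortSum_add, add_neg_cancel_comm, norm_neg, ← shortSum_add] at h3
  linarith

lemma sum_sup_norm_sq_le {q : ℕ} [NeZero q] {χ : DirichletCharacter ℂ q}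
    (hχ : χ.IsPrimitive) {H K J : ℕ} (hH : 1 ≤ H) (hHq : H ≤ q) (hK : 2 * H < 2 ^ K)
    (hK' : 2 ^ K ≤ 4 * H) {N : ℕ → ℕ} (hN : ∀ j, 1 ≤ j → j < J → N j + H ≤ N (j + 1))
    (hNq : ∀ j, 1 ≤ j → j ≤ J → N j < q) :
    ∑ j ∈ Icc 1 J, (Icc 1 H).sup' (nonempty_Icc.mpr hH)
        (fun h => ‖∑ n ∈ Ioc (N j) (N j + h), χ (n : ZMod q)‖ ^ 2) ≤
      64 * (K : ℝ) ^ 2 * q := by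
  set G : ℕ → ℝ := fun n => dyadicMajorant χ K ((n : ZMod q) + 1 - H) with hG
  have hG0 (n : ℕ) : 0 ≤ G n := dyadicMajorant_nonneg _ _ _
  have hS (n h : ℕ) : ∑ m ∈ Ioc n (n + h), χ (m : ZMod q) = shortSum χ (n + 1) h := by
    rw [shortSum, ← Ico_add_one_add_one_eq_Ioc, sum_Ico_eq_sum_range]
    simp [add_right_comm n h 1]
  have hsup (j : ℕ) : H * (Icc 1 H).sup' (nonempty_Icc.mpr hH)
        (fun h => ‖∑ n ∈ Ioc (N j) (N j + h), χ (n : ZMod q)‖ ^ 2) ≤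
      ∑ n ∈ Ico (N j) (N j + H), 4 * G n := by
    have hc : H = #(Ico (N j) (N j + H)) := by simp
    nth_rw 1 [hc]
    rw [← nsmul_eq_mul]
    refine card_nsmul_le_sum _ _ _ fun n hn => sup'_le _ _ fun h hh => ?_
    rw [mem_Ico] at hn
    rw [hS]
    have hsh := norm_shortSum_sq_le_of_shift χ hK (mem_Icc.1 hh).2
      (show N j + H - n ≤ H by omega) ((n : ZMod q) + 1 - H)
    have hx : (n : ZMod q) + 1 - H + (N j + H - n : ℕ) = N j + 1 := by
      rw [Nat.cast_sub (by omega)]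
      push_cast
      ring
    rwa [hx] at hsh
  have htotal : ∑ n ∈ range (q + q), G n ≤ 2 * (2 * (K : ℝ) ^ 2 * 2 ^ K * q) := by
    rw [sum_range_add]
    have hper (n : ℕ) : G (q + n) = G n := by simp [hG]
    simp_rw [hper]
    have : ∑ n ∈ range q, G n = ∑ x, dyadicMajorant χ K x := by
      rw [sum_range_natCast_zmod (fun x : ZMod q => dyadicMajorant χ K (x + 1 - H))]
      simp_rw [add_sub_assoc]
      exact Equiv.sum_comp (Equiv.addRight ((1 : ZMod q) - H)) (dyadicMajorant χ K)
    rw [this, ← two_mul]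
    gcongr
    exact sum_dyadicMajorant_le hχ (by omega)
  have hH0 : (0 : ℝ) < H := by exact_mod_cast hH
  have h2K : (2 : ℝ) ^ K ≤ 4 * H := by exact_mod_cast hK'
  refine le_of_mul_le_mul_left ?_ hH0
  rw [mul_sum]
  calc _ ≤ ∑ j ∈ Icc 1 J, ∑ n ∈ Ico (N j) (N j + H), 4 * G n := sum_le_sum fun j _ => hsup j
    _ = 4 * ∑ j ∈ Icc 1 J, ∑ n ∈ Ico (N j) (N j + H), G n := by simp_rw [mul_sum]
    _ ≤ 4 * (2 * (2 * (K : ℝ) ^ 2 * 2 ^ K * q)) := by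
        gcongr
        refine (sum_sum_Ico_le_sum_range hG0 hN fun j h1 h2 => ?_).trans htotal
        have := hNq j h1 h2
        omega
    _ ≤ 4 * (2 * (2 * (K : ℝ) ^ 2 * (4 * H) * q)) := by gcongr
    _ = _ := by ring

lemma natCast_sq_le_rpow_of_two_pow_le {ε : ℝ} (hε : 0 < ε) {K q : ℕ} (hK : 2 ^ K ≤ 4 * q) :
    (K : ℝ) ^ 2 ≤ 4 ^ ε / (ε / 2 * Real.log 2) ^ 2 * (q : ℝ) ^ ε := by
  have hlog2 : 0 < Real.log 2 := Real.log_pos one_lt_two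
  have h1 : K * Real.log 2 ≤ (4 * q : ℝ) ^ (ε / 2) / (ε / 2) := by
    rw [← Real.log_pow]
    refine (Real.log_le_log (by positivity) ?_).trans
      (Real.log_le_rpow_div (by positivity) (half_pos hε))
    exact_mod_cast hK
  have h2 : (K : ℝ) ≤ (4 * q : ℝ) ^ (ε / 2) / (ε / 2 * Real.log 2) := by
    rwa [← div_div, le_div_iff₀ hlog2]
  calc (K : ℝ) ^ 2 ≤ ((4 * q : ℝ) ^ (ε / 2) / (ε / 2 * Real.log 2)) ^ 2 := by gcongr
    _ = _ := by
      rw [div_pow, ← Real.rpow_natCast ((4 * q : ℝ) ^ (ε / 2)), ← Real.rpow_mul (by positivity)]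
      rw [Nat.cast_ofNat, div_mul_cancel₀ _ two_ne_zero,
        Real.mul_rpow (by norm_num) (by positivity)]
      ring


/-- For a primitive Dirichlet character `χ` mod `q`, with `S(N; h) = ∑_{N < n ≤ N + h} χ(n)`,
and `H`-spaced points `0 ≤ N_1 < ⋯ < N_J < q`, we have
`∑_{j=1}^J max_{1 ≤ h ≤ H} |S(N_j; h)|² ≤ C(ε) q^{1+ε}`. -/
theorem stmt_0 (ε : ℝ) (hε : 0 < ε) :
    ∃ C : ℝ, ∀ (q : ℕ), 0 < q →
      ∀ (χ : DirichletCharacter ℂ q), DirichletCharacter.IsPrimitive χ →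
      ∀ (H : ℕ) (hH : 1 ≤ H), H ≤ q →
      ∀ (J : ℕ) (N : ℕ → ℕ),
        (∀ j, 1 ≤ j → j < J → N j + H ≤ N (j + 1)) →
        (∀ j, 1 ≤ j → j ≤ J → N j < q) →
        ∑ j ∈ Finset.Icc 1 J,
            (Finset.Icc 1 H).sup' (Finset.nonempty_Icc.mpr hH)
              (fun h => ‖∑ n ∈ Finset.Ioc (N j) (N j + h), χ (n : ZMod q)‖ ^ 2)
          ≤ C * (q : ℝ) ^ ((1 : ℝ) + ε) := by
  refine ⟨64 * (4 ^ ε / (ε / 2 * Real.log 2) ^ 2), fun q hq χ hχ H hH hHq J N hN hNq => ?_⟩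
  have : NeZero q := ⟨hq.ne'⟩
  have hK : 2 * H < 2 ^ (Nat.log 2 (2 * H) + 1) := Nat.lt_pow_succ_log_self one_lt_two _
  have hK' : 2 ^ (Nat.log 2 (2 * H) + 1) ≤ 4 * H := by
    have := Nat.pow_log_le_self 2 (show 2 * H ≠ 0 by omega)
    rw [pow_succ]
    omega
  have hK2 := natCast_sq_le_rpow_of_two_pow_le hε (hK'.trans (by omega : 4 * H ≤ 4 * q))
  refine (sum_sup_norm_sq_le hχ hH hHq hK hK' hN hNq).trans ?_
  rw [Real.rpow_add (by exact_mod_cast hq), Real.rpow_one]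
  calc _ ≤ 64 * (4 ^ ε / (ε / 2 * Real.log 2) ^ 2 * (q : ℝ) ^ ε) * q := by gcongr
    _ = _ := by ring
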